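/- Let b, c, d, e, g ∈ ℂ with e, g, 1+e−g, 2−g all not equal to a nonpositive integer. Then the function u(x,y) = y^{1−g} · F2(b, c, 1+d−g; 1+e−g; 2−g; x, y), where y^{1−g} = exp((1−g)·log y) for y > 0, satisfies at every point of D = {(x,y) ∈ ℝ² : 0 < x < 1, 0 < y} the second-order partial differential equation x(1−x)·u_xx + y·u_xy + [e − (b+c+1)x]·u_x − bc·u = 0. -/

import Mathlib

noncomputable def poch (a : ℂ) (n : ℕ) : ℂ := ∏ i ∈ Finset.range n, (a + i)

noncomputable def pdx (u : ℝ → ℝ → ℂ) : ℝ → ℝ → ℂ := fun x y => deriv (fun t => u t y) x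
noncomputable def pdy (u : ℝ → ℝ → ℂ) : ℝ → ℝ → ℂ := fun x y => deriv (fun t => u x t) y

/-- Kampé de Fériet function of the third order. -/
noncomputable def F2 (b c d e g x y : ℂ) : ℂ :=
  ∑' p : ℕ × ℕ,
    poch b p.1 * poch c p.1 * poch d p.2 /
      (poch e (p.1 + p.2) * poch g p.2 * (Nat.factorial p.1 : ℂ) * (Nat.factorial p.2 : ℂ)) *
      x ^ p.1 * y ^ p.2

/-- The sum of the double power series with coefficients `A`. -/
noncomputable def doubleSeries (A : ℕ → ℕ → ℂ) (x y : ℂ) : ℂ :=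
  ∑' p : ℕ × ℕ, A p.1 p.2 * x ^ p.1 * y ^ p.2

/-- The coefficients of the formal derivative of a double power series in the first variable. -/
def coeffDerivFst (A : ℕ → ℕ → ℂ) (m n : ℕ) : ℂ := (m + 1) * A (m + 1) n

/-- The coefficients of the formal derivative of a double power series in the second variable. -/
def coeffDerivSnd (A : ℕ → ℕ → ℂ) (m n : ℕ) : ℂ := (n + 1) * A m (n + 1)

/-- The terms of the double power series with coefficients `A` are bounded on some polyradius
strictly larger than `(‖x‖, ‖y‖)`. -/
def BoundedBeyond (A : ℕ → ℕ → ℂ) (x y : ℂ) : Prop :=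
  ∃ r R C : ℝ, ‖x‖ < r ∧ ‖y‖ < R ∧ ∀ m n, ‖A m n‖ * r ^ m * R ^ n ≤ C

/-- The coefficients of `F2` as a double power series. -/
noncomputable def kampeCoeff (b c d e g : ℂ) (m n : ℕ) : ℂ :=
  poch b m * poch c m * poch d n /
    (poch e (m + n) * poch g n * (Nat.factorial m : ℂ) * (Nat.factorial n : ℂ))

theorem bounded_of_eventually_succ_le {u : ℕ → ℝ} {N : ℕ}
    (h : ∀ n, N ≤ n → u (n + 1) ≤ u n) : ∃ C, 0 ≤ C ∧ ∀ n, u n ≤ C := by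
  have hs (n : ℕ) (hn : n ∈ Finset.range (N + 1)) :
      u n ≤ ∑ i ∈ Finset.range (N + 1), |u i| :=
    (le_abs_self _).trans
      (Finset.single_le_sum (f := fun i => |u i|) (fun i _ => abs_nonneg _) hn)
  refine ⟨∑ i ∈ Finset.range (N + 1), |u i|, Finset.sum_nonneg fun i _ => abs_nonneg _,
    fun n => ?_⟩
  rcases le_total n N with hn | hn
  · exact hs n (by simp; omega)
  · induction n, hn using Nat.le_induction with
    | base => exact hs N (by simp)
    | succ k hk ih => exact (h k hk).trans ih

theorem poch_succ (a : ℂ) (n : ℕ) : poch a (n + 1) = poch a n * (a + n) := by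
  simp [poch, Finset.prod_range_succ]

theorem poch_ne_zero {a : ℂ} (ha : ∀ n : ℕ, a ≠ -(n : ℂ)) (n : ℕ) : poch a n ≠ 0 :=
  Finset.prod_ne_zero_iff.mpr fun i _ h => ha i (eq_neg_of_add_eq_zero_left h)

theorem norm_poch_mul_pow_le (a : ℂ) {ρ : ℝ} (h0 : 0 < ρ) (h1 : ρ < 1) :
    ∃ C, 0 ≤ C ∧ ∀ n : ℕ, ‖poch a n‖ * ρ ^ n ≤ C * n.factorial := by
  obtain ⟨N, hN⟩ := exists_nat_ge (‖a‖ / (1 - ρ))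
  obtain ⟨C, hC, h⟩ := bounded_of_eventually_succ_le
    (u := fun n => ‖poch a n‖ * ρ ^ n / n.factorial) (N := N) (fun n hn => by
      have hn' : ‖a‖ ≤ n * (1 - ρ) :=
        (div_le_iff₀ (by linarith)).mp (hN.trans (by exact_mod_cast hn))
      have hle : ‖a + n‖ * ρ ≤ n + 1 := by
        have : ‖a + n‖ ≤ ‖a‖ + n := by simpa using norm_add_le a (n : ℂ)
        nlinarith [norm_nonneg a, norm_nonneg (a + n)]
      have hf : (0 : ℝ) < n.factorial := by positivity
      rw [poch_succ, norm_mul, Nat.factorial_succ, pow_succ, div_le_div_iff₀ (by positivity) hf]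
      push_cast
      have := mul_le_mul_of_nonneg_left hle
        (show 0 ≤ ‖poch a n‖ * ρ ^ n * n.factorial by positivity)
      linarith)
  exact ⟨C, hC, fun n => (div_le_iff₀ (by positivity)).mp (h n)⟩

theorem factorial_mul_pow_le_norm_poch {a : ℂ} (ha : ∀ n : ℕ, a ≠ -(n : ℂ)) {ρ : ℝ}
    (h0 : 0 < ρ) (h1 : ρ < 1) :
    ∃ C, 0 ≤ C ∧ ∀ n : ℕ, n.factorial * ρ ^ n ≤ C * ‖poch a n‖ := by
  obtain ⟨N, hN⟩ := exists_nat_ge ((‖a‖ + 1) / (1 - ρ))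
  have hp (n : ℕ) : 0 < ‖poch a n‖ := norm_pos_iff.mpr (poch_ne_zero ha n)
  obtain ⟨C, hC, h⟩ := bounded_of_eventually_succ_le
    (u := fun n => n.factorial * ρ ^ n / ‖poch a n‖) (N := N) (fun n hn => by
      have hn' : ‖a‖ + 1 ≤ n * (1 - ρ) :=
        (div_le_iff₀ (by linarith)).mp (hN.trans (by exact_mod_cast hn))
      have hle : (n + 1) * ρ ≤ ‖a + n‖ := by
        have : (n : ℝ) ≤ ‖a + n‖ + ‖a‖ := by simpa using norm_sub_le (a + n) a
        nlinarith
      rw [div_le_div_iff₀ (hp _) (hp _), poch_succ, norm_mul, Nat.factorial_succ, pow_succ]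
      push_cast
      have := mul_le_mul_of_nonneg_left hle
        (show 0 ≤ ‖poch a n‖ * ρ ^ n * n.factorial by positivity)
      linarith)
  exact ⟨C, hC, fun n => (div_le_iff₀ (hp n)).mp (h n)⟩

theorem kampeCoeff_boundedBeyond {b c d e g : ℂ} (he : ∀ n : ℕ, e ≠ -(n : ℂ))
    (hg : ∀ n : ℕ, g ≠ -(n : ℂ)) {x : ℂ} (hx : ‖x‖ < 1) (y : ℂ) :
    BoundedBeyond (kampeCoeff b c d e g) x y := by
  obtain ⟨ρ, h0, h1, hρ⟩ : ∃ ρ : ℝ, 0 < ρ ∧ ρ < 1 ∧ ‖x‖ < ρ ^ 3 := by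
    have hx0 := norm_nonneg x
    refine ⟨1 - (1 - ‖x‖) / 4, by linarith, by linarith, ?_⟩
    have := one_add_mul_le_pow (a := -((1 - ‖x‖) / 4)) (by linarith) 3
    push_cast at this
    rw [sub_eq_add_neg]
    linarith
  obtain ⟨B, hB, hb⟩ := norm_poch_mul_pow_le b h0 h1
  obtain ⟨C, hC, hc⟩ := norm_poch_mul_pow_le c h0 h1
  obtain ⟨D, hD, hd⟩ := norm_poch_mul_pow_le d h0 h1
  obtain ⟨E, hE, he'⟩ := factorial_mul_pow_le_norm_poch he h0 h1
  obtain ⟨G, hG, hg'⟩ := factorial_mul_pow_le_norm_poch hg h0 h1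
  set T : ℝ := (‖y‖ + 1) / ρ ^ 3 with hT
  have hT0 : 0 ≤ T := by positivity
  refine ⟨ρ ^ 3, ‖y‖ + 1, B * C * D * E * G * Real.exp T, hρ, by linarith, fun m n => ?_⟩
  have hy : ‖y‖ + 1 = T * ρ ^ 3 := by rw [hT]; field_simp
  have hpe : 0 < ‖poch e (m + n)‖ := norm_pos_iff.mpr (poch_ne_zero he _)
  have hpg : 0 < ‖poch g n‖ := norm_pos_iff.mpr (poch_ne_zero hg _)
  have hm : (0 : ℝ) < m.factorial := by positivity
  have hn : (0 : ℝ) < n.factorial := by positivity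
  have hexp : T ^ n ≤ Real.exp T * n.factorial * n.factorial :=
    ((div_le_iff₀ hn).mp (Real.pow_div_factorial_le_exp T hT0 n)).trans
      (le_mul_of_one_le_right (by positivity) (by exact_mod_cast n.factorial_pos))
  have hfac : (m.factorial * n.factorial : ℝ) * ρ ^ (m + n) ≤ E * ‖poch e (m + n)‖ := by
    refine le_trans ?_ (he' (m + n))
    gcongr
    exact_mod_cast Nat.le_of_dvd (Nat.factorial_pos _)
      (Nat.factorial_mul_factorial_dvd_factorial_add m n)
  rw [kampeCoeff, norm_div, hy]
  simp only [norm_mul, Complex.norm_natCast]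
  rw [div_mul_eq_mul_div, div_mul_eq_mul_div, div_le_iff₀ (by positivity)]
  refine le_of_mul_le_mul_right (a := (m.factorial * n.factorial * n.factorial : ℝ)) ?_
    (by positivity)
  calc
    ‖poch b m‖ * ‖poch c m‖ * ‖poch d n‖ * (ρ ^ 3) ^ m * (T * ρ ^ 3) ^ n *
        (m.factorial * n.factorial * n.factorial)
      = (‖poch b m‖ * ρ ^ m) * (‖poch c m‖ * ρ ^ m) * (‖poch d n‖ * ρ ^ n) *
        ((m.factorial * n.factorial : ℝ) * ρ ^ (m + n)) * (n.factorial * ρ ^ n) * T ^ n := by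
          rw [mul_pow T, ← pow_mul, ← pow_mul, mul_comm 3 m, mul_comm 3 n, pow_mul, pow_mul, pow_add]
          ring
    _ ≤ (B * m.factorial) * (C * m.factorial) * (D * n.factorial) *
        (E * ‖poch e (m + n)‖) * (G * ‖poch g n‖) * (Real.exp T * n.factorial * n.factorial) := by
          gcongr ?_ * ?_ * ?_ * ?_ * ?_ * ?_
          exacts [hb m, hc m, hd n, hg' n]
    _ = _ := by ring

namespace BoundedBeyond

variable {A : ℕ → ℕ → ℂ} {x y : ℂ}

theorem swap (h : BoundedBeyond A x y) : BoundedBeyond (fun m n => A n m) y x := by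
  obtain ⟨r, R, C, hr, hR, hC⟩ := h
  exact ⟨R, r, C, hR, hr, fun m n => by rw [mul_right_comm]; exact hC n m⟩

theorem summable (h : BoundedBeyond A x y) :
    Summable fun p : ℕ × ℕ => A p.1 p.2 * x ^ p.1 * y ^ p.2 := by
  obtain ⟨r, R, C, hr, hR, hC⟩ := h
  have hr0 : 0 < r := (norm_nonneg x).trans_lt hr
  have hR0 : 0 < R := (norm_nonneg y).trans_lt hR
  have hs : Summable fun p : ℕ × ℕ => C * ((‖x‖ / r) ^ p.1 * (‖y‖ / R) ^ p.2) := by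
    refine Summable.mul_left _ (Summable.mul_of_nonneg ?_ ?_ ?_ ?_)
    · exact summable_geometric_of_lt_one (by positivity) ((div_lt_one hr0).mpr hr)
    · exact summable_geometric_of_lt_one (by positivity) ((div_lt_one hR0).mpr hR)
    · intro n; simp only [Pi.zero_apply]; positivity
    · intro n; simp only [Pi.zero_apply]; positivity
  refine Summable.of_norm_bounded hs fun p => ?_
  have := mul_le_mul_of_nonneg_right (hC p.1 p.2)
    (show 0 ≤ (‖x‖ / r) ^ p.1 * (‖y‖ / R) ^ p.2 by positivity)
  refine le_trans (le_of_eq ?_) this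
  simp only [norm_mul, norm_pow, div_pow]
  field_simp

theorem natCast_mul (h : BoundedBeyond A x y) :
    BoundedBeyond (fun m n => (m : ℂ) * A m n) x y := by
  obtain ⟨r, R, C, hr, hR, hC⟩ := h
  obtain ⟨s, hs, hsr⟩ := exists_between hr
  have hs0 : 0 < s := (norm_nonneg x).trans_lt hs
  have hr0 : 0 < r := hs0.trans hsr
  have hR0 : 0 < R := (norm_nonneg y).trans_lt hR
  obtain ⟨K, hK⟩ := (tendsto_self_mul_const_pow_of_lt_one (r := s / r) (by positivity)
    ((div_lt_one hr0).mpr hsr)).bddAbove_range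
  have hK' (m : ℕ) : m * (s / r) ^ m ≤ K := hK ⟨m, rfl⟩
  have hC0 : 0 ≤ C := le_trans (by positivity) (hC 0 0)
  refine ⟨s, R, C * K, hs, hR, fun m n => ?_⟩
  refine le_trans (le_of_eq ?_) (mul_le_mul (hC m n) (hK' m) (by positivity) hC0)
  simp only [norm_mul, Complex.norm_natCast, div_pow]
  field_simp

theorem shift (h : BoundedBeyond A x y) : BoundedBeyond (fun m n => A (m + 1) n) x y := by
  obtain ⟨r, R, C, hr, hR, hC⟩ := h
  have hr0 : 0 < r := (norm_nonneg x).trans_lt hr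
  refine ⟨r, R, C / r, hr, hR, fun m n => (le_div_iff₀ hr0).mpr ?_⟩
  exact le_trans (le_of_eq (by ring)) (hC (m + 1) n)

theorem coeffDerivFst (h : BoundedBeyond A x y) : BoundedBeyond (coeffDerivFst A) x y := by
  have := h.natCast_mul.shift
  simp only [Nat.cast_add, Nat.cast_one] at this
  exact this

end BoundedBeyond

theorem tsum_natCast_mul_fst (A : ℕ → ℕ → ℂ) (x y : ℂ) :
    ∑' p : ℕ × ℕ, A p.1 p.2 * (p.1 * x ^ (p.1 - 1)) * y ^ p.2 =
      doubleSeries (coeffDerivFst A) x y := by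
  have hinj : Function.Injective fun p : ℕ × ℕ => (p.1 + 1, p.2) := by
    rintro ⟨a, b⟩ ⟨c, d⟩ h
    simpa using h
  rw [doubleSeries, ← hinj.tsum_eq]
  · refine tsum_congr fun p => ?_
    simp only [coeffDerivFst, Nat.add_sub_cancel]
    push_cast
    ring
  · rintro ⟨m, n⟩ hp
    cases m with
    | zero => simp at hp
    | succ m => exact ⟨(m, n), rfl⟩

theorem mul_doubleSeries_coeffDerivFst (A : ℕ → ℕ → ℂ) (x y : ℂ) :
    x * doubleSeries (coeffDerivFst A) x y = doubleSeries (fun m n => m * A m n) x y := by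
  rw [← tsum_natCast_mul_fst, ← tsum_mul_left, doubleSeries]
  refine tsum_congr fun p => ?_
  rcases p with ⟨_ | m, n⟩
  · simp
  · simp only [Nat.add_sub_cancel]; ring

theorem doubleSeries_swap (A : ℕ → ℕ → ℂ) (x y : ℂ) :
    doubleSeries (fun m n => A n m) y x = doubleSeries A x y := by
  rw [doubleSeries, doubleSeries, ← (Equiv.prodComm ℕ ℕ).tsum_eq]
  exact tsum_congr fun p => by simp [mul_right_comm]

theorem mul_doubleSeries_coeffDerivSnd (A : ℕ → ℕ → ℂ) (x y : ℂ) :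
    y * doubleSeries (coeffDerivSnd A) x y = doubleSeries (fun m n => n * A m n) x y := by
  rw [← doubleSeries_swap, ← doubleSeries_swap (fun m n => (n : ℂ) * A m n)]
  exact mul_doubleSeries_coeffDerivFst (fun m n => A n m) y x

theorem BoundedBeyond.hasDerivAt_fst {A : ℕ → ℕ → ℂ} {x y : ℂ} (h : BoundedBeyond A x y) :
    HasDerivAt (fun t => doubleSeries A t y) (doubleSeries (_root_.coeffDerivFst A) x y) x := by
  rw [← tsum_natCast_mul_fst]
  have hs := h.summable
  obtain ⟨r, R, C, hr, hR, hC⟩ := h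
  obtain ⟨s, hs', hsr⟩ := exists_between hr
  have hs0 : 0 < s := (norm_nonneg x).trans_lt hs'
  have hb : BoundedBeyond A (s : ℂ) y :=
    ⟨r, R, C, by rwa [Complex.norm_real, Real.norm_of_nonneg hs0.le], hR, hC⟩
  have hu : Summable fun p : ℕ × ℕ =>
      ‖(p.1 : ℂ) * A p.1 p.2 * (s : ℂ) ^ p.1 * y ^ p.2‖ * s⁻¹ :=
    hb.natCast_mul.summable.norm.mul_right s⁻¹
  have hx : x ∈ Metric.ball (0 : ℂ) s := by simpa using hs'
  have hderiv (p : ℕ × ℕ) (t : ℂ) (_ : t ∈ Metric.ball (0 : ℂ) s) :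
      HasDerivAt (fun t => A p.1 p.2 * t ^ p.1 * y ^ p.2)
        (A p.1 p.2 * (p.1 * t ^ (p.1 - 1)) * y ^ p.2) t :=
    ((hasDerivAt_pow p.1 t).const_mul _).mul_const _
  have hbound (p : ℕ × ℕ) (t : ℂ) (ht : t ∈ Metric.ball (0 : ℂ) s) :
      ‖A p.1 p.2 * (p.1 * t ^ (p.1 - 1)) * y ^ p.2‖ ≤
        ‖(p.1 : ℂ) * A p.1 p.2 * (s : ℂ) ^ p.1 * y ^ p.2‖ * s⁻¹ := by
    have ht' : ‖t‖ ≤ s := (mem_ball_zero_iff.mp ht).le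
    obtain ⟨m, n⟩ := p
    cases m with
    | zero => simp
    | succ m =>
      simp only [norm_mul, norm_pow, Complex.norm_natCast, Complex.norm_real,
        Real.norm_of_nonneg hs0.le, Nat.add_sub_cancel]
      calc ‖A (m + 1) n‖ * ((m + 1 : ℕ) * ‖t‖ ^ m) * ‖y‖ ^ n
          ≤ ‖A (m + 1) n‖ * ((m + 1 : ℕ) * s ^ m) * ‖y‖ ^ n := by gcongr
        _ = (m + 1 : ℕ) * ‖A (m + 1) n‖ * s ^ (m + 1) * ‖y‖ ^ n * s⁻¹ := by
          rw [pow_succ]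
          field_simp
  exact hasDerivAt_tsum_of_isPreconnected hu Metric.isOpen_ball
    (convex_ball _ _).isPreconnected hderiv hbound hx hs hx

theorem BoundedBeyond.hasDerivAt_snd {A : ℕ → ℕ → ℂ} {x y : ℂ} (h : BoundedBeyond A x y) :
    HasDerivAt (fun t => doubleSeries A x t) (doubleSeries (coeffDerivSnd A) x y) y := by
  have := h.swap.hasDerivAt_fst
  simp only [doubleSeries_swap A] at this
  rw [← doubleSeries_swap (coeffDerivSnd A)]
  exact this

theorem kampeCoeff_succ_left {b c d e g : ℂ} (he : ∀ n : ℕ, e ≠ -(n : ℂ)) (m n : ℕ) :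
    (m + n + e) * ((m + 1) * kampeCoeff b c d e g (m + 1) n) =
      (m + b) * (m + c) * kampeCoeff b c d e g m n := by
  have hmn : e + ((m + n : ℕ) : ℂ) ≠ 0 := fun h => he (m + n) (eq_neg_of_add_eq_zero_left h)
  have hm : (m : ℂ) + 1 ≠ 0 := Nat.cast_add_one_ne_zero m
  simp only [kampeCoeff, Nat.add_right_comm m 1 n, poch_succ, Nat.factorial_succ]
  rw [show (m + n + e : ℂ) = e + ((m + n : ℕ) : ℂ) by push_cast; ring]
  generalize e + ((m + n : ℕ) : ℂ) = q at *
  push_cast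
  generalize (m : ℂ) + 1 = k at *
  rw [mul_div_assoc', mul_div_assoc', mul_div_assoc',
    show poch e (m + n) * q * poch g n * (k * (m.factorial : ℂ)) * (n.factorial : ℂ) =
      (q * k) * (poch e (m + n) * poch g n * (m.factorial : ℂ) * (n.factorial : ℂ)) by ring,
    show q * (k * (poch b m * (b + m) * (poch c m * (c + m)) * poch d n)) =
      (q * k) * ((m + b) * (m + c) * (poch b m * poch c m * poch d n)) by ring,
    mul_div_mul_left _ _ (mul_ne_zero hmn hm)]

/-- The first of the partial differential equations satisfied by `F2`, in terms of coefficients. -/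
theorem doubleSeries_kampeCoeff_equation {b c d e g x y : ℂ} (he : ∀ n : ℕ, e ≠ -(n : ℂ))
    (h : BoundedBeyond (kampeCoeff b c d e g) x y) :
    x * (1 - x) * doubleSeries (coeffDerivFst (coeffDerivFst (kampeCoeff b c d e g))) x y +
      y * doubleSeries (coeffDerivSnd (coeffDerivFst (kampeCoeff b c d e g))) x y +
      (e - (b + c + 1) * x) * doubleSeries (coeffDerivFst (kampeCoeff b c d e g)) x y -
      b * c * doubleSeries (kampeCoeff b c d e g) x y = 0 := by
  have hrec := kampeCoeff_succ_left (b := b) (c := c) (d := d) (g := g) he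
  generalize kampeCoeff b c d e g = A at *
  have hB := h.coeffDerivFst
  have hxx : x * doubleSeries (fun m n => m * coeffDerivFst A m n) x y =
      doubleSeries (fun m n => m * ((m - 1) * A m n)) x y := by
    rw [← mul_doubleSeries_coeffDerivFst (fun m n => ((m : ℂ) - 1) * A m n)]
    congr 2
    funext m n
    simp only [coeffDerivFst]
    push_cast
    ring
  have key : doubleSeries (fun m n => m * coeffDerivFst A m n) x y +
      doubleSeries (fun m n => n * coeffDerivFst A m n) x y +
      e * doubleSeries (coeffDerivFst A) x y -
      doubleSeries (fun m n => m * ((m - 1) * A m n)) x y -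
      (b + c + 1) * doubleSeries (fun m n => m * A m n) x y - b * c * doubleSeries A x y = 0 := by
    have s₁ := hB.natCast_mul.summable.hasSum
    have s₂ := hB.swap.natCast_mul.swap.summable.hasSum
    have s₃ := hB.summable.hasSum.mul_left e
    have s₄ := (h.natCast_mul.natCast_mul.summable.sub h.natCast_mul.summable).hasSum
    have s₅ := h.natCast_mul.summable.hasSum.mul_left (b + c + 1)
    have s₆ := h.summable.hasSum.mul_left (b * c)
    have h₄ : doubleSeries (fun m n => m * ((m - 1) * A m n)) x y = _ :=
      tsum_congr fun p : ℕ × ℕ =>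
        show (p.1 : ℂ) * ((p.1 - 1) * A p.1 p.2) * x ^ p.1 * y ^ p.2 =
          p.1 * (p.1 * A p.1 p.2) * x ^ p.1 * y ^ p.2 - p.1 * A p.1 p.2 * x ^ p.1 * y ^ p.2 by
            ring
    rw [h₄]
    refine (((((s₁.add s₂).add s₃).sub s₄).sub s₅).sub s₆).unique ?_
    convert hasSum_zero with p
    simp only [coeffDerivFst]
    linear_combination (x ^ p.1 * y ^ p.2) * hrec p.1 p.2
  rw [← hxx, ← mul_doubleSeries_coeffDerivFst, ← mul_doubleSeries_coeffDerivFst A,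
    ← mul_doubleSeries_coeffDerivSnd] at key
  linear_combination key

theorem stmt6 (b c d e g : ℂ)
    (he : ∀ n : ℕ, e ≠ -(n : ℂ)) (hg : ∀ n : ℕ, g ≠ -(n : ℂ))
    (he' : ∀ n : ℕ, (1 + e - g) ≠ -(n : ℂ)) (hg' : ∀ n : ℕ, (2 - g) ≠ -(n : ℂ))
    (u : ℝ → ℝ → ℂ)
    (hu : u = fun x y : ℝ => Complex.exp ((1 - g) * (Real.log y : ℂ)) * F2 b c (1 + d - g) (1 + e - g) (2 - g) (x : ℂ) (y : ℂ)) :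
    ∀ x y : ℝ, 0 < x → x < 1 → 0 < y →
      (x : ℂ) * (1 - (x : ℂ)) * pdx (pdx u) x y + (y : ℂ) * pdy (pdx u) x y
        + (e - (b + c + 1) * (x : ℂ)) * pdx u x y - b * c * u x y = 0 := by
  have hF (x y : ℂ) : F2 b c (1 + d - g) (1 + e - g) (2 - g) x y =
      doubleSeries (kampeCoeff b c (1 + d - g) (1 + e - g) (2 - g)) x y := rfl
  intro x y hx0 hx1 hy
  have hb (t s : ℝ) (ht : t ∈ Set.Ioo (0 : ℝ) 1) :
      BoundedBeyond (kampeCoeff b c (1 + d - g) (1 + e - g) (2 - g)) t s :=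
    kampeCoeff_boundedBeyond he' hg'
      (by rw [Complex.norm_real, Real.norm_of_nonneg ht.1.le]; exact ht.2) s
  have heq := doubleSeries_kampeCoeff_equation he' (hb x y ⟨hx0, hx1⟩)
  simp only [hF] at hu
  generalize kampeCoeff b c (1 + d - g) (1 + e - g) (2 - g) = A at *
  have hux (t s : ℝ) (ht : t ∈ Set.Ioo (0 : ℝ) 1) : pdx u t s =
      Complex.exp ((1 - g) * (Real.log s : ℂ)) * doubleSeries (coeffDerivFst A) t s := by
    rw [hu]
    exact ((hb t s ht).hasDerivAt_fst.comp_ofReal.const_mul _).deriv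
  have hB := (hb x y ⟨hx0, hx1⟩).coeffDerivFst
  have huxx : pdx (pdx u) x y = Complex.exp ((1 - g) * (Real.log y : ℂ)) *
      doubleSeries (coeffDerivFst (coeffDerivFst A)) x y := by
    have hev : (fun t => pdx u t y) =ᶠ[nhds x] fun t : ℝ =>
        Complex.exp ((1 - g) * (Real.log y : ℂ)) * doubleSeries (coeffDerivFst A) t y := by
      filter_upwards [Ioo_mem_nhds hx0 hx1] with t ht using hux t y ht
    rw [pdx, hev.deriv_eq]
    exact (hB.hasDerivAt_fst.comp_ofReal.const_mul _).deriv
  have huxy : pdy (pdx u) x y = Complex.exp ((1 - g) * (Real.log y : ℂ)) *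
      ((1 - g) * (y⁻¹ : ℝ)) * doubleSeries (coeffDerivFst A) x y +
      Complex.exp ((1 - g) * (Real.log y : ℂ)) *
        doubleSeries (coeffDerivSnd (coeffDerivFst A)) x y := by
    have hlog := (((Real.hasDerivAt_log hy.ne').ofReal_comp).const_mul (1 - g)).cexp
    simp only [pdy, hux x _ ⟨hx0, hx1⟩]
    exact (hlog.mul hB.hasDerivAt_snd.comp_ofReal).deriv
  have hyy : (y : ℂ) * (y⁻¹ : ℝ) = 1 := by
    rw [← Complex.ofReal_mul, mul_inv_cancel₀ hy.ne', Complex.ofReal_one]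
  rw [huxx, huxy, hux x y ⟨hx0, hx1⟩, hu]
  linear_combination Complex.exp ((1 - g) * (Real.log y : ℂ)) * heq +
    Complex.exp ((1 - g) * (Real.log y : ℂ)) * (1 - g) *
      doubleSeries (coeffDerivFst A) x y * hyy
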